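/- The number S(K,r,s) of partitions of V(K) into r s-independent blocks equals Σ_{T ∈ L^s(K)} μ(∅,T)·S(|π(T)|, r), where S(n,r) denotes the Stirling number of the second kind and μ is the Möbius function of L^s(K). -/

import Mathlib

open Finset

/-- The number of (r,s)-colorings of the simplicial complex `K` on vertex set `V`:
maps `V → Fin r` with no monochrome s-simplex. -/
noncomputable def chromCount {V : Type*} [Fintype V] (K : Finset (Finset V)) (r s : ℕ) : ℕ :=
  Nat.card {col : V → Fin r // ∀ σ ∈ K, σ.card = s + 1 → ¬ ∃ c, ∀ v ∈ σ, col v = c}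

/-- `simpStirling K i s` : the number of partitions of the vertex set into `i`
s-independent blocks (blocks containing no s-simplex of `K`). -/
noncomputable def simpStirling {V : Type*} [Fintype V] [DecidableEq V]
    (K : Finset (Finset V)) (i s : ℕ) : ℕ :=
  Nat.card {P : Finpartition (Finset.univ : Finset V) //
    P.parts.card = i ∧ ∀ B ∈ P.parts, ∀ σ ∈ K, σ.card = s + 1 → ¬ σ ⊆ B}
/-- The vertex set `V(S) = ⋃ S` of a set `S` of simplices. -/
def vertSet {V : Type*} (S : Set (Finset V)) : Set V := ⋃ σ ∈ S, (σ : Set V)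

/-- A set `S` of s-simplices of `K` is closed if it contains every s-simplex of `K`
whose vertices all lie in `V(S)`. -/
def IsClosedSet {V : Type*} (K : Finset (Finset V)) (s : ℕ) (S : Set (Finset V)) : Prop :=
  ∀ σ ∈ K, σ.card = s + 1 → (σ : Set V) ⊆ vertSet S → σ ∈ S

/-- The relation on simplices of `S` of having nonempty intersection. -/
def simpRel {V : Type*} [DecidableEq V] (S : Set (Finset V)) (a b : Finset V) : Prop :=
  a ∈ S ∧ b ∈ S ∧ (a ∩ b).Nonempty

/-- `S0` is a connected component of `S`: an equivalence class of the smallest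
equivalence relation on `S` generated by nonempty pairwise intersection. -/
def IsComponent {V : Type*} [DecidableEq V] (S S0 : Set (Finset V)) : Prop :=
  ∃ σ₀ ∈ S, S0 = {τ | τ ∈ S ∧ Relation.EqvGen (simpRel S) σ₀ τ}

/-- The set of s-simplices of `K`, as a set. -/
def sSimplices {V : Type*} (K : Finset (Finset V)) (s : ℕ) : Set (Finset V) :=
  {σ : Finset V | σ ∈ K ∧ σ.card = s + 1}

/-- The s-chromatic lattice: subsets of `F^s(K)` all of whose connected components
are closed. -/
def LsK {V : Type*} [DecidableEq V] (K : Finset (Finset V)) (s : ℕ) : Set (Set (Finset V)) :=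
  {S | S ⊆ sSimplices K s ∧ ∀ S0, IsComponent S S0 → IsClosedSet K s S0}

/-- The number of blocks `|π(T)|` of the partition of `V(K)` induced by `T`. -/
noncomputable def piCard {V : Type*} [Fintype V] [DecidableEq V]
    (T : Set (Finset V)) : ℕ :=
  Set.ncard {S0 : Set (Finset V) | IsComponent T S0} +
    (Fintype.card V - (vertSet T).ncard)

/-- The Stirling number of the second kind: the number of partitions of an
`n`-element set into `r` blocks. -/
noncomputable def stirling2 (n r : ℕ) : ℕ :=
  Nat.card {P : Finpartition (Finset.univ : Finset (Fin n)) // P.parts.card = r}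

/-- Finpartitions of a finite type correspond to setoids. -/
noncomputable def fpEquiv (α : Type*) [Fintype α] [DecidableEq α] :
    Finpartition (Finset.univ : Finset α) ≃ Setoid α := by
  classical
  exact
  { toFun := fun P => Setoid.ker P.part
    invFun := fun x => Finpartition.ofSetoid x
    left_inv := by
      intro P
      have key : ∀ a, (Finpartition.ofSetoid (Setoid.ker P.part)).part a = P.part a := by
        intro a
        ext b
        rw [Finpartition.mem_part_ofSetoid_iff_rel, Setoid.ker_def,
          P.mem_part_iff_part_eq_part (Finset.mem_univ _) (Finset.mem_univ _)]
        exact eq_comm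
      ext B
      constructor
      · intro hB
        obtain ⟨a, -, rfl⟩ := Finpartition.part_surjOn _ hB
        rw [key]; simp
      · intro hB
        obtain ⟨a, -, rfl⟩ := Finpartition.part_surjOn _ hB
        rw [← key]; simp
    right_inv := by
      intro x
      ext a b
      rw [Setoid.ker_def, ← Finpartition.mem_part_iff_part_eq_part _ (Finset.mem_univ _)
        (Finset.mem_univ _), Finpartition.mem_part_ofSetoid_iff_rel]
      exact ⟨x.symm', x.symm'⟩ }

theorem fpEquiv_rel {α : Type*} [Fintype α] [DecidableEq α]
    (P : Finpartition (Finset.univ : Finset α)) (a b : α) :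
    fpEquiv α P a b ↔ P.part a = P.part b := Iff.rfl

theorem fpEquiv_card {α : Type*} [Fintype α] [DecidableEq α]
    (P : Finpartition (Finset.univ : Finset α)) :
    Nat.card (Quotient (fpEquiv α P)) = P.parts.card := by
  have h : Set.range P.part = (P.parts : Set (Finset α)) := by
    ext B
    constructor
    · rintro ⟨a, rfl⟩; simp
    · intro hB
      obtain ⟨a, -, rfl⟩ := Finpartition.part_surjOn _ hB
      exact ⟨a, rfl⟩
  have h2 := Nat.card_congr (Setoid.quotientKerEquivRange P.part)
  rw [h] at h2
  refine Eq.trans h2 ?_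
  simp

theorem stirling2_eq {β : Type*} [Finite β] (n r : ℕ) (h : Nat.card β = n) :
    stirling2 n r = Nat.card {x : Setoid β // Nat.card (Quotient x) = r} := by
  classical
  have e : Fin n ≃ β := (Finite.equivFinOfCardEq h).symm
  have : Fintype β := Fintype.ofFinite β
  rw [stirling2]
  apply Nat.card_congr
  refine (Equiv.subtypeEquiv (fpEquiv (Fin n)) (q := fun x => Nat.card (Quotient x) = r) ?_).trans ?_
  · intro P; rw [fpEquiv_card]
  · refine Equiv.subtypeEquiv
      { toFun := fun x => x.comap e.symm
        invFun := fun x => x.comap e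
        left_inv := ?_
        right_inv := ?_ } ?_
    · intro x; ext a b; simp [Setoid.comap_rel]
    · intro x; ext a b; simp [Setoid.comap_rel]
    · intro x
      have : Nat.card (Quotient x) = Nat.card (Quotient (x.comap e.symm)) := by
        apply Nat.card_congr
        refine Quotient.congr e ?_
        intro a b
        change x a b ↔ (x.comap e.symm) (e a) (e b)
        simp [Setoid.comap_rel]
      simp only [Equiv.coe_fn_mk, this]

section
variable {V : Type*} [DecidableEq V]

/-- Classifying map of the partition `π(T)`. -/
noncomputable def compMap (T : Set (Finset V)) (v : V) : Set (Finset V) ⊕ V :=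
  open Classical in
  if v ∈ vertSet T then
    Sum.inl {τ | τ ∈ T ∧ ∃ σ ∈ T, v ∈ σ ∧ Relation.EqvGen (simpRel T) σ τ}
  else Sum.inr v

theorem mem_vertSet {T : Set (Finset V)} {v : V} : v ∈ vertSet T ↔ ∃ σ ∈ T, v ∈ σ := by
  simp [vertSet]

theorem compMap_of_mem {T : Set (Finset V)} {v : V} {σ : Finset V} (hσ : σ ∈ T) (hv : v ∈ σ) :
    compMap T v = Sum.inl {τ | τ ∈ T ∧ Relation.EqvGen (simpRel T) σ τ} := by
  rw [compMap, if_pos (mem_vertSet.2 ⟨σ, hσ, hv⟩)]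
  congr 1
  ext τ
  constructor
  · rintro ⟨h, σ', hσ', hv', h'⟩
    refine ⟨h, .trans _ _ _ (.rel _ _ ⟨hσ, hσ', v, ?_⟩) h'⟩
    simp [hv, hv']
  · rintro ⟨h, h'⟩
    exact ⟨h, σ, hσ, hv, h'⟩

theorem eqvGen_same {T : Set (Finset V)} (x : Setoid V)
    (hne : ∀ σ ∈ T, σ.Nonempty) (hx : ∀ σ ∈ T, ∀ u ∈ σ, ∀ v ∈ σ, x u v) {σ τ : Finset V}
    (h : Relation.EqvGen (simpRel T) σ τ) :
    σ = τ ∨ (σ ∈ T ∧ τ ∈ T ∧ ∀ u ∈ σ, ∀ v ∈ τ, x u v) := by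
  induction h with
  | rel a b h =>
    obtain ⟨ha, hb, w, hw⟩ := h
    rw [Finset.mem_inter] at hw
    exact Or.inr ⟨ha, hb, fun u hu v hv => x.trans' (hx a ha u hu w hw.1) (hx b hb w hw.2 v hv)⟩
  | refl a => exact Or.inl rfl
  | symm a b _ ih =>
    rcases ih with rfl | ⟨ha, hb, h⟩
    · exact Or.inl rfl
    · exact Or.inr ⟨hb, ha, fun u hu v hv => x.symm' (h v hv u hu)⟩
  | trans a b c h1 h2 ih1 ih2 =>
    rcases ih1 with rfl | ⟨ha, hb, h⟩
    · exact ih2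
    rcases ih2 with rfl | ⟨hb', hc, h'⟩
    · exact Or.inr ⟨ha, hb, h⟩
    refine Or.inr ⟨ha, hc, fun u hu v hv => ?_⟩
    obtain ⟨w, hw⟩ := hne b hb
    exact x.trans' (h u hu w hw) (h' w hw v hv)

theorem ker_compMap_le_iff {T : Set (Finset V)} (hne : ∀ σ ∈ T, σ.Nonempty) (x : Setoid V) :
    Setoid.ker (compMap T) ≤ x ↔ ∀ σ ∈ T, ∀ u ∈ σ, ∀ v ∈ σ, x u v := by
  constructor
  · intro h σ hσ u hu v hv
    apply h
    rw [Setoid.ker_def, compMap_of_mem hσ hu, compMap_of_mem hσ hv]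
  · intro hx u v huv
    rw [Setoid.ker_def] at huv
    by_cases hu : u ∈ vertSet T
    · obtain ⟨σ, hσ, hu'⟩ := mem_vertSet.1 hu
      by_cases hv : v ∈ vertSet T
      · obtain ⟨τ, hτ, hv'⟩ := mem_vertSet.1 hv
        rw [compMap_of_mem hσ hu', compMap_of_mem hτ hv', Sum.inl.injEq] at huv
        have hm : τ ∈ {τ | τ ∈ T ∧ Relation.EqvGen (simpRel T) σ τ} := by
          rw [huv]; exact ⟨hτ, .refl _⟩
        rcases eqvGen_same x hne hx hm.2 with rfl | ⟨-, -, h⟩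
        · exact hx _ hσ _ hu' _ hv'
        · exact h _ hu' _ hv'
      · rw [compMap, compMap, if_pos hu, if_neg hv] at huv
        cases huv
    · by_cases hv : v ∈ vertSet T
      · rw [compMap, compMap, if_neg hu, if_pos hv] at huv
        cases huv
      · rw [compMap, compMap, if_neg hu, if_neg hv, Sum.inr.injEq] at huv
        rw [huv]

theorem card_quotient_compMap [Fintype V] {T : Set (Finset V)} (hne : ∀ σ ∈ T, σ.Nonempty) :
    Nat.card (Quotient (Setoid.ker (compMap T))) = piCard T := by
  have h : Set.range (compMap T) =
      Sum.inl '' {S0 | IsComponent T S0} ∪ Sum.inr '' (vertSet T)ᶜ := by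
    ext y
    constructor
    · rintro ⟨v, rfl⟩
      by_cases hv : v ∈ vertSet T
      · obtain ⟨σ, hσ, hv'⟩ := mem_vertSet.1 hv
        rw [compMap_of_mem hσ hv']
        exact Or.inl ⟨_, ⟨σ, hσ, rfl⟩, rfl⟩
      · rw [compMap, if_neg hv]
        exact Or.inr ⟨v, hv, rfl⟩
    · rintro (⟨S0, ⟨σ, hσ, rfl⟩, rfl⟩ | ⟨v, hv, rfl⟩)
      · obtain ⟨v, hv⟩ := hne σ hσ
        exact ⟨v, compMap_of_mem hσ hv⟩
      · exact ⟨v, by rw [compMap, if_neg hv]⟩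
  rw [Nat.card_congr (Setoid.quotientKerEquivRange _), Nat.card_coe_set_eq, h,
    Set.ncard_union_eq ?_ (Set.toFinite _) (Set.toFinite _),
    Set.ncard_image_of_injective _ Sum.inl_injective,
    Set.ncard_image_of_injective _ Sum.inr_injective, piCard, Set.ncard_compl,
    Nat.card_eq_fintype_card]
  rw [Set.disjoint_left]
  rintro _ ⟨a, -, rfl⟩ ⟨b, -, h⟩
  cases h

theorem count_above [Fintype V] {T : Set (Finset V)} (hne : ∀ σ ∈ T, σ.Nonempty) (r : ℕ) :
    stirling2 (piCard T) r = Nat.card {x : Setoid V //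
      Nat.card (Quotient x) = r ∧ ∀ σ ∈ T, ∀ u ∈ σ, ∀ v ∈ σ, x u v} := by
  rw [stirling2_eq _ r (card_quotient_compMap hne)]
  symm
  set e := Setoid.ker (compMap T) with he
  apply Nat.card_congr
  have e1 : {x : Setoid V // Nat.card (Quotient x) = r ∧ ∀ σ ∈ T, ∀ u ∈ σ, ∀ v ∈ σ, x u v} ≃
      {y : {x : Setoid V // e ≤ x} // Nat.card (Quotient y.1) = r} :=
    { toFun := fun x => ⟨⟨x.1, (ker_compMap_le_iff hne _).2 x.2.2⟩, x.2.1⟩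
      invFun := fun y => ⟨y.1.1, y.2, (ker_compMap_le_iff hne _).1 y.1.2⟩
      left_inv := fun _ => rfl
      right_inv := fun _ => rfl }
  refine e1.trans (Equiv.subtypeEquiv (Setoid.correspondence e).toEquiv ?_)
  rintro ⟨x, hx⟩
  have : Nat.card (Quotient x) = Nat.card (Quotient (Setoid.correspondence e ⟨x, hx⟩)) := by
    apply Nat.card_congr
    refine Equiv.ofBijective (Quotient.map (sa := x) (Quotient.mk e) (fun a b h => h)) ⟨?_, ?_⟩
    · intro a b
      induction a using Quotient.inductionOn
      induction b using Quotient.inductionOn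
      intro h
      have h' := Quotient.exact (s := Setoid.correspondence e ⟨x, hx⟩) h
      exact Quotient.sound (s := x) h'
    · intro q
      induction q using Quotient.inductionOn with | _ q =>
      induction q using Quotient.inductionOn with | _ q =>
      exact ⟨Quotient.mk x q, rfl⟩
  change Nat.card (Quotient x) = r ↔ Nat.card (Quotient (Setoid.correspondence e ⟨x, hx⟩)) = r
  rw [this]

/-- The monochromatic `s`-simplices of a setoid. -/
def mono (K : Finset (Finset V)) (s : ℕ) (x : Setoid V) : Set (Finset V) :=
  {σ | σ ∈ sSimplices K s ∧ ∀ u ∈ σ, ∀ v ∈ σ, x u v}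

theorem sSimplices_nonempty {K : Finset (Finset V)} {s : ℕ} {σ : Finset V}
    (h : σ ∈ sSimplices K s) : σ.Nonempty := by
  rw [← Finset.card_pos, h.2]; omega

theorem mono_mem (K : Finset (Finset V)) (s : ℕ) (x : Setoid V) : mono K s x ∈ LsK K s := by
  refine ⟨fun σ h => h.1, ?_⟩
  rintro S0 ⟨σ₀, hσ₀, rfl⟩ σ hσ hc hsub
  have hF : σ ∈ sSimplices K s := ⟨hσ, hc⟩
  have hne : ∀ σ ∈ mono K s x, σ.Nonempty := fun σ h => sSimplices_nonempty h.1
  obtain ⟨w, hw⟩ := hne _ hσ₀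
  have hw' : ∀ u ∈ σ, x w u := by
    intro u hu
    obtain ⟨τ, ⟨hτ, hgen⟩, huτ⟩ := mem_vertSet.1 (hsub hu)
    rcases eqvGen_same x hne (fun σ h => h.2) hgen with rfl | ⟨-, -, h⟩
    · exact hτ.2 _ hw _ huτ
    · exact h _ hw _ huτ
  have hm : σ ∈ mono K s x := ⟨hF, fun u hu v hv => x.trans' (x.symm' (hw' u hu)) (hw' v hv)⟩
  refine ⟨hm, ?_⟩
  obtain ⟨u, hu⟩ := sSimplices_nonempty hF
  obtain ⟨τ, ⟨hτ, hgen⟩, huτ⟩ := mem_vertSet.1 (hsub hu)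
  exact .trans _ _ _ hgen (.rel _ _ ⟨hτ, hm, u, by rw [Finset.mem_inter]; exact ⟨huτ, hu⟩⟩)

theorem empty_mem_LsK (K : Finset (Finset V)) (s : ℕ) : (∅ : Set (Finset V)) ∈ LsK K s := by
  refine ⟨Set.empty_subset _, ?_⟩
  rintro S0 ⟨σ, h, -⟩
  exact h.elim

theorem simpStirling_eq [Fintype V] (K : Finset (Finset V)) (r s : ℕ) :
    simpStirling K r s =
      Nat.card {x : Setoid V // Nat.card (Quotient x) = r ∧ mono K s x = ∅} := by
  rw [simpStirling]
  apply Nat.card_congr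
  refine Equiv.subtypeEquiv (fpEquiv V) ?_
  intro P
  rw [fpEquiv_card]
  refine and_congr_right fun _ => ?_
  rw [Set.eq_empty_iff_forall_notMem]
  constructor
  · intro h σ hσ
    obtain ⟨w, hw⟩ := sSimplices_nonempty hσ.1
    refine h (P.part w) (by simp) σ hσ.1.1 hσ.1.2 ?_
    intro u hu
    rw [P.mem_part_iff_part_eq_part (Finset.mem_univ _) (Finset.mem_univ _)]
    exact hσ.2 u hu w hw
  · intro h B hB σ hσ hc hsub
    refine h σ ⟨⟨hσ, hc⟩, fun u hu v hv => ?_⟩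
    rw [fpEquiv_rel, P.part_eq_of_mem hB (hsub hu), P.part_eq_of_mem hB (hsub hv)]

end

/-- `S(K,r,s) = ∑_{T ∈ L^s(K)} μ(∅,T)·S(|π(T)|, r)`. -/
theorem stmt_13 {V : Type*} [Fintype V] [DecidableEq V]
    (K : Finset (Finset V)) (hK : ∀ σ ∈ K, ∀ τ, τ ⊆ σ → τ ∈ K)
    (r s : ℕ) (hs : 1 ≤ s)
    (μ : Set (Finset V) → ℤ)
    (hμ0 : μ ∅ = 1)
    (hμ : ∀ T ∈ LsK K s, T ≠ ∅ → ∑ᶠ S ∈ {S | S ∈ LsK K s ∧ S ⊆ T}, μ S = 0) :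
    (simpStirling K r s : ℤ) =
      ∑ᶠ T ∈ LsK K s, μ T * (stirling2 (piCard T) r : ℤ) := by
  classical
  have : Finite (Setoid V) := Finite.of_equiv _ (fpEquiv V)
  have : Fintype (Setoid V) := Fintype.ofFinite _
  have : Fintype (Set (Finset V)) := Fintype.ofFinite _
  have hμ' : ∀ T ∈ LsK K s, (∑ S : Set (Finset V), if S ∈ LsK K s ∧ S ⊆ T then μ S else 0)
      = if T = ∅ then 1 else 0 := by
    intro T hT
    split_ifs with h
    · subst h
      rw [Finset.sum_eq_single ∅]
      · rw [if_pos ⟨hT, subset_rfl⟩, hμ0]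
      · intro S _ hS
        rw [if_neg]
        rintro ⟨-, h⟩
        exact hS (Set.subset_empty_iff.1 h)
      · simp
    · refine Eq.trans ?_ (hμ T hT h)
      rw [finsum_mem_def, finsum_eq_sum_of_fintype]
      refine Finset.sum_congr rfl fun S _ => ?_
      simp [Set.indicator_apply]
  have key : ∀ T ∈ LsK K s, (stirling2 (piCard T) r : ℤ) =
      ∑ x : Setoid V, if Nat.card (Quotient x) = r ∧ T ⊆ mono K s x then 1 else 0 := by
    intro T hT
    rw [count_above (fun σ h => sSimplices_nonempty (hT.1 h)), Nat.card_eq_fintype_card,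
      Fintype.card_subtype, Finset.sum_boole]
    congr 2
    ext x
    simp only [Finset.mem_filter, Finset.mem_univ, true_and]
    refine and_congr_right fun _ => ?_
    exact ⟨fun h σ hσ => ⟨hT.1 hσ, h σ hσ⟩, fun h σ hσ => (h hσ).2⟩
  rw [simpStirling_eq, Nat.card_eq_fintype_card, Fintype.card_subtype, finsum_mem_def,
    finsum_eq_sum_of_fintype]
  calc _ = ∑ x : Setoid V, if Nat.card (Quotient x) = r ∧ mono K s x = ∅ then (1 : ℤ) else 0 := by
        rw [Finset.sum_boole]
    _ = ∑ x : Setoid V, if Nat.card (Quotient x) = r then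
          (∑ S : Set (Finset V), if S ∈ LsK K s ∧ S ⊆ mono K s x then μ S else 0) else 0 := by
        refine Finset.sum_congr rfl fun x _ => ?_
        rw [hμ' _ (mono_mem K s x), ite_and]
    _ = ∑ x : Setoid V, ∑ S : Set (Finset V), if S ∈ LsK K s then
          μ S * (if Nat.card (Quotient x) = r ∧ S ⊆ mono K s x then 1 else 0) else 0 := by
        refine Finset.sum_congr rfl fun x _ => ?_
        split_ifs with h
        · refine Finset.sum_congr rfl fun S _ => ?_
          by_cases h1 : S ∈ LsK K s <;> by_cases h2 : S ⊆ mono K s x <;> simp [-Nat.card_eq_fintype_card, h, h1, h2]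
        · symm
          apply Finset.sum_eq_zero
          intro S _
          simp [-Nat.card_eq_fintype_card, h]
    _ = _ := by
        rw [Finset.sum_comm]
        refine Finset.sum_congr rfl fun S _ => ?_
        rw [Set.indicator_apply]
        split_ifs with h
        · rw [key S h, Finset.mul_sum]
        · simp
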